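/- (Lyapunov decrease, inequality (26) of the paper.) In the setting of the one-step estimate, assume in addition that θ⁺ ∈ (0,1] satisfies (1−θ⁺)/θ⁺ ≤ 1/θ, and that Φ̂⁺(I) ≥ Φ(x*) for every I ∈ 𝓘. Define V = ((1−θ)/θ)·(Φ̂ − Φ(x*)) + (σ(1−θ)²/θ²)·(h(s) − h(x*)) + (1/2)‖x − x*‖²_{P²T} and, for each I ∈ 𝓘, V⁺(I) = ((1−θ⁺)/θ⁺)·(Φ̂⁺(I) − Φ(x*)) + (σ(1−θ⁺)²/(θ⁺)²)·(h(s⁺(I)) − h(x*)) + (1/2)‖x⁺(I) − x*‖²_{P²T}. Then E_{I∼Π}[ V⁺(I) ] ≤ V − σ·(h(x) − h(x*)) − (1/2)‖x̂ − x‖²_{PT − Λ − σΣ}. -/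

import Mathlib

open Matrix

/-- `h(x) = (1/2)‖Ax − b‖²` written with the dot product. -/
noncomputable def quadH {m q : ℕ} (A : Matrix (Fin q) (Fin m) ℝ) (b : Fin q → ℝ)
    (x : Fin m → ℝ) : ℝ := (1 / 2) * ((A *ᵥ x - b) ⬝ᵥ (A *ᵥ x - b))

/-- `∇h(x) = Aᵀ(Ax − b)`. -/
noncomputable def gradH {m q : ℕ} (A : Matrix (Fin q) (Fin m) ℝ) (b : Fin q → ℝ)
    (x : Fin m → ℝ) : Fin m → ℝ := Aᵀ *ᵥ (A *ᵥ x - b)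

/-- `‖x‖_M² = ⟨Mx, x⟩`. -/
noncomputable def mNormSq {m : ℕ} (M : Matrix (Fin m) (Fin m) ℝ) (x : Fin m → ℝ) : ℝ :=
  (M *ᵥ x) ⬝ᵥ x

/-- `U_I = Σ_{i∈I} U_i`: the 0/1 diagonal matrix selecting the blocks in `I`. -/
def blockUSet {m d : ℕ} (blk : Fin m → Fin d) (I : Finset (Fin d)) :
    Matrix (Fin m) (Fin m) ℝ :=
  Matrix.diagonal (fun j => if blk j ∈ I then 1 else 0)

/-- `p_i = Prob_{I∼Π}(i ∈ I)`. -/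
noncomputable def pblock {d : ℕ} (Pi : Finset (Fin d) → ℝ) (i : Fin d) : ℝ :=
  ∑ I ∈ Finset.univ.filter (fun I : Finset (Fin d) => i ∈ I), Pi I

/-- `P = diag(p_1⁻¹ Id_{m_1},…,p_d⁻¹ Id_{m_d})`. -/
noncomputable def Pmat {m d : ℕ} (blk : Fin m → Fin d) (Pi : Finset (Fin d) → ℝ) :
    Matrix (Fin m) (Fin m) ℝ :=
  Matrix.diagonal (fun j => (pblock Pi (blk j))⁻¹)

/-- `Σ = E_{I∼Π}[U_I P AᵀA P U_I]`. -/
noncomputable def SigmaMat {m q d : ℕ} (A : Matrix (Fin q) (Fin m) ℝ)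
    (blk : Fin m → Fin d) (Pi : Finset (Fin d) → ℝ) : Matrix (Fin m) (Fin m) ℝ :=
  ∑ I : Finset (Fin d),
    Pi I • (blockUSet blk I * Pmat blk Pi * (Aᵀ * A) * Pmat blk Pi * blockUSet blk I)

/-- The continuous linear map `u ↦ v ⬝ᵥ u`, used to express gradients. -/
noncomputable def dotCLM {m : ℕ} (v : Fin m → ℝ) : (Fin m → ℝ) →L[ℝ] ℝ :=
  LinearMap.toContinuousLinearMap
    { toFun := fun u => v ⬝ᵥ u
      map_add' := fun u w => by simp [dotProduct_add]
      map_smul' := fun c u => by simp }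

section Quadratic

variable {m q : ℕ} (A : Matrix (Fin q) (Fin m) ℝ) (b : Fin q → ℝ)

lemma gradH_dotProduct {y : Fin m → ℝ} (hy : Aᵀ *ᵥ (A *ᵥ y - b) = 0) (z v : Fin m → ℝ) :
    gradH A b z ⬝ᵥ v = (A *ᵥ (z - y)) ⬝ᵥ (A *ᵥ v) := by
  have h : gradH A b z = Aᵀ *ᵥ (A *ᵥ (z - y)) := by
    rw [gradH, ← sub_zero (Aᵀ *ᵥ _), ← hy, ← mulVec_sub, mulVec_sub A]
    congr 1
    abel
  rw [h, mulVec_transpose, ← dotProduct_mulVec]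

lemma quadH_sub {y : Fin m → ℝ} (hy : Aᵀ *ᵥ (A *ᵥ y - b) = 0) (u : Fin m → ℝ) :
    quadH A b u - quadH A b y = (1 / 2) * ((A *ᵥ (u - y)) ⬝ᵥ (A *ᵥ (u - y))) := by
  have h : A *ᵥ u - b = A *ᵥ (u - y) + (A *ᵥ y - b) := by rw [mulVec_sub]; abel
  have h0 : (A *ᵥ y - b) ⬝ᵥ (A *ᵥ (u - y)) = 0 := by
    rw [dotProduct_mulVec, ← mulVec_transpose, hy, zero_dotProduct]
  rw [quadH, quadH, h, add_dotProduct, dotProduct_add, dotProduct_add, h0,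
    dotProduct_comm _ (A *ᵥ y - b), h0]
  ring

lemma quadH_add_sub {y : Fin m → ℝ} (hy : Aᵀ *ᵥ (A *ᵥ y - b) = 0) (z : Fin m → ℝ) (t : ℝ)
    (v : Fin m → ℝ) :
    quadH A b (z + t • v) - quadH A b y = (quadH A b z - quadH A b y) + t * (gradH A b z ⬝ᵥ v)
      + t ^ 2 / 2 * ((A *ᵥ v) ⬝ᵥ (A *ᵥ v)) := by
  rw [quadH_sub A b hy, quadH_sub A b hy, gradH_dotProduct A b hy, add_sub_right_comm,
    mulVec_add, mulVec_smul]
  simp only [add_dotProduct, dotProduct_add, smul_dotProduct, dotProduct_smul, smul_eq_mul]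
  rw [dotProduct_comm (A *ᵥ v) (A *ᵥ (z - y))]
  ring

lemma quadH_convexComb_sub {y : Fin m → ℝ} (hy : Aᵀ *ᵥ (A *ᵥ y - b) = 0) (t : ℝ)
    (s x z : Fin m → ℝ) (hz : z = (1 - t) • s + t • x) :
    (quadH A b z - quadH A b y) - t * (gradH A b z ⬝ᵥ (x - y))
      = (1 - t) ^ 2 * (quadH A b s - quadH A b y) - t ^ 2 * (quadH A b x - quadH A b y) := by
  have h : z - y = (1 - t) • (s - y) + t • (x - y) := by rw [hz]; module
  simp only [quadH_sub A b hy, gradH_dotProduct A b hy, h]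
  simp only [mulVec_add, mulVec_smul, add_dotProduct, dotProduct_add, smul_dotProduct,
    dotProduct_smul, smul_eq_mul]
  rw [dotProduct_comm (A *ᵥ (x - y)) (A *ᵥ (s - y))]
  ring

end Quadratic

section WeightedNorm

variable {m : ℕ}

lemma dotProduct_mulVec_comm_of_isSymm {M : Matrix (Fin m) (Fin m) ℝ} (hM : M.IsSymm)
    (u v : Fin m → ℝ) : (M *ᵥ u) ⬝ᵥ v = (M *ᵥ v) ⬝ᵥ u := by
  rw [dotProduct_comm, dotProduct_mulVec, ← mulVec_transpose, hM.eq]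

lemma mNormSq_add {M : Matrix (Fin m) (Fin m) ℝ} (hM : M.IsSymm) (u v : Fin m → ℝ) :
    mNormSq M (u + v) = mNormSq M u + 2 * ((M *ᵥ u) ⬝ᵥ v) + mNormSq M v := by
  simp only [mNormSq, mulVec_add, add_dotProduct, dotProduct_add]
  rw [dotProduct_mulVec_comm_of_isSymm hM v u]
  ring

lemma mNormSq_smul (M : Matrix (Fin m) (Fin m) ℝ) (t : ℝ) (v : Fin m → ℝ) :
    mNormSq M (t • v) = t ^ 2 * mNormSq M v := by
  simp only [mNormSq, mulVec_smul, smul_dotProduct, dotProduct_smul, smul_eq_mul]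
  ring

lemma nonneg_of_forall_mul_add_sq_nonneg {a c : ℝ}
    (h : ∀ t : ℝ, 0 < t → t ≤ 1 → 0 ≤ t * a + t ^ 2 * c) : 0 ≤ a := by
  by_contra! ha
  have hd : 0 < |c| - a + 1 := by linarith [abs_nonneg c]
  have h1 : -a / (|c| - a + 1) ≤ 1 := by
    rw [div_le_one hd]; linarith [abs_nonneg c]
  have h0 : 0 < -a / (|c| - a + 1) := div_pos (by linarith) hd
  have h2 := h _ h0 h1
  set t := -a / (|c| - a + 1) with ht
  have h3 : 0 ≤ a + t * c := by
    by_contra! h4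
    nlinarith
  have h5 : t * (|c| - a + 1) = -a := by rw [ht]; field_simp
  nlinarith [le_abs_self c]

/-- The three-point inequality for a proximal step in a (not necessarily definite) metric. -/
lemma prox_three_point {r : (Fin m → ℝ) → EReal}
    (hrConvex : ∀ u v : Fin m → ℝ, ∀ a c : ℝ, 0 ≤ a → 0 ≤ c → a + c = 1 →
      r (a • u + c • v) ≤ (a : EReal) * r u + (c : EReal) * r v)
    {M : Matrix (Fin m) (Fin m) ℝ} (hM : M.IsSymm) {c x xhat y : Fin m → ℝ}
    (hmin : ∀ u : Fin m → ℝ,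
      ((c ⬝ᵥ xhat + (1 / 2) * mNormSq M (xhat - x) : ℝ) : EReal) + r xhat
        ≤ ((c ⬝ᵥ u + (1 / 2) * mNormSq M (u - x) : ℝ) : EReal) + r u)
    {ρ ρy : ℝ} (hρ : r xhat = (ρ : EReal)) (hρy : r y = (ρy : EReal)) :
    c ⬝ᵥ (xhat - y) + ρ + (1 / 2) * mNormSq M (xhat - x)
      ≤ ρy + (1 / 2) * mNormSq M (x - y) - (1 / 2) * mNormSq M (x - y + (xhat - x)) := by
  have key : 0 ≤ c ⬝ᵥ (y - xhat) + (M *ᵥ (xhat - x)) ⬝ᵥ (y - xhat) + ρy - ρ := by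
    refine nonneg_of_forall_mul_add_sq_nonneg (c := (1 / 2) * mNormSq M (y - xhat)) ?_
    intro t ht0 ht1
    have h1 := hmin ((1 - t) • xhat + t • y)
    have h2 := hrConvex xhat y (1 - t) t (by linarith) ht0.le (by ring)
    have h3 := h1.trans (add_le_add_right h2 _)
    rw [hρ, hρy] at h3
    norm_cast at h3
    have e1 : (1 - t) • xhat + t • y = xhat + t • (y - xhat) := by module
    have e2 : xhat + t • (y - xhat) - x = (xhat - x) + t • (y - xhat) := by module
    rw [e1, e2, mNormSq_add hM, mNormSq_smul] at h3
    simp only [dotProduct_add, dotProduct_smul, smul_eq_mul] at h3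
    linarith
  have e3 : x - y = (xhat - y) + (-1 : ℝ) • (xhat - x) := by module
  have e4 : x - y + (xhat - x) = xhat - y := by abel
  have e5 : y - xhat = -(xhat - y) := by abel
  rw [e4, e3, mNormSq_add hM, mNormSq_smul, dotProduct_smul,
    dotProduct_mulVec_comm_of_isSymm hM (xhat - y)]
  rw [e5, dotProduct_neg, dotProduct_neg] at key
  simp only [smul_eq_mul]
  linarith

end WeightedNorm

section Sampling

variable {m q d : ℕ} (blk : Fin m → Fin d) (Pi : Finset (Fin d) → ℝ)

lemma diagonal_comm_of_block {T : Matrix (Fin m) (Fin m) ℝ}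
    (hT : ∀ j j' : Fin m, blk j ≠ blk j' → T j j' = 0) (f : Fin d → ℝ) :
    diagonal (fun j => f (blk j)) * T = T * diagonal (fun j => f (blk j)) := by
  ext i j
  rw [diagonal_mul, mul_diagonal]
  by_cases h : blk i = blk j
  · rw [h, mul_comm]
  · simp [hT i j h]

lemma Pmat_comm {T : Matrix (Fin m) (Fin m) ℝ}
    (hT : ∀ j j' : Fin m, blk j ≠ blk j' → T j j' = 0) :
    Pmat blk Pi * T = T * Pmat blk Pi :=
  diagonal_comm_of_block blk hT fun i => (pblock Pi i)⁻¹

lemma blockUSet_comm {T : Matrix (Fin m) (Fin m) ℝ}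
    (hT : ∀ j j' : Fin m, blk j ≠ blk j' → T j j' = 0) (I : Finset (Fin d)) :
    blockUSet blk I * T = T * blockUSet blk I :=
  diagonal_comm_of_block blk hT fun i => if i ∈ I then 1 else 0

lemma Pmat_mul_block {T : Matrix (Fin m) (Fin m) ℝ}
    (hT : ∀ j j' : Fin m, blk j ≠ blk j' → T j j' = 0) (j j' : Fin m) (h : blk j ≠ blk j') :
    (Pmat blk Pi * T) j j' = 0 := by
  rw [Pmat, diagonal_mul, hT j j' h, mul_zero]

lemma Pmat_isSymm : (Pmat blk Pi).IsSymm := isSymm_diagonal _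

lemma blockUSet_isSymm (I : Finset (Fin d)) : (blockUSet blk I).IsSymm := isSymm_diagonal _

lemma blockUSet_mul_self (I : Finset (Fin d)) :
    blockUSet blk I * blockUSet blk I = blockUSet blk I := by
  simp [blockUSet, diagonal_mul_diagonal]

lemma blockUSet_Pmat_comm (I : Finset (Fin d)) :
    blockUSet blk I * Pmat blk Pi = Pmat blk Pi * blockUSet blk I := by
  simp [blockUSet, Pmat, diagonal_mul_diagonal, mul_comm]

lemma sum_mul_dotProduct_blockUSet (c v : Fin m → ℝ) :
    ∑ I : Finset (Fin d), Pi I * (c ⬝ᵥ (blockUSet blk I *ᵥ v))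
      = c ⬝ᵥ fun j => pblock Pi (blk j) * v j := by
  simp only [dotProduct, blockUSet, mulVec_diagonal, Finset.mul_sum]
  rw [Finset.sum_comm]
  refine Finset.sum_congr rfl fun j _ => ?_
  rw [pblock, Finset.sum_mul, Finset.mul_sum, Finset.sum_filter]
  refine Finset.sum_congr rfl fun I _ => ?_
  split_ifs <;> ring

variable {Pi} in
lemma sum_mul_Pmat_dotProduct_blockUSet (hpPos : ∀ i, 0 < pblock Pi i) (c v : Fin m → ℝ) :
    ∑ I : Finset (Fin d), Pi I * ((Pmat blk Pi *ᵥ c) ⬝ᵥ (blockUSet blk I *ᵥ v)) = c ⬝ᵥ v := by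
  rw [sum_mul_dotProduct_blockUSet]
  refine Finset.sum_congr rfl fun j _ => ?_
  have := (hpPos (blk j)).ne'
  rw [Pmat, mulVec_diagonal]
  field_simp

variable {Pi} in
lemma sum_mul_dotProduct_blockUSet_mul_Pmat (hpPos : ∀ i, 0 < pblock Pi i) (c v : Fin m → ℝ) :
    ∑ I : Finset (Fin d), Pi I * (c ⬝ᵥ ((blockUSet blk I * Pmat blk Pi) *ᵥ v)) = c ⬝ᵥ v := by
  rw [← sum_mul_Pmat_dotProduct_blockUSet blk hpPos c v]
  refine Finset.sum_congr rfl fun I _ => ?_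
  rw [blockUSet_Pmat_comm, ← mulVec_mulVec, dotProduct_mulVec, ← mulVec_transpose,
    (Pmat_isSymm blk Pi).eq]

lemma mNormSq_SigmaMat (A : Matrix (Fin q) (Fin m) ℝ) (v : Fin m → ℝ) :
    mNormSq (SigmaMat A blk Pi) v = ∑ I : Finset (Fin d), Pi I *
      ((A *ᵥ ((blockUSet blk I * Pmat blk Pi) *ᵥ v)) ⬝ᵥ
        (A *ᵥ ((blockUSet blk I * Pmat blk Pi) *ᵥ v))) := by
  rw [mNormSq, SigmaMat, sum_mulVec, sum_dotProduct]
  refine Finset.sum_congr rfl fun I _ => ?_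
  have h : blockUSet blk I * Pmat blk Pi * (Aᵀ * A) * Pmat blk Pi * blockUSet blk I
      = (A * (blockUSet blk I * Pmat blk Pi))ᵀ * (A * (blockUSet blk I * Pmat blk Pi)) := by
    rw [transpose_mul, transpose_mul, (Pmat_isSymm blk Pi).eq, (blockUSet_isSymm blk I).eq,
      blockUSet_Pmat_comm]
    simp only [Matrix.mul_assoc]
  rw [smul_mulVec, smul_dotProduct, smul_eq_mul, h, ← mulVec_mulVec, mulVec_transpose,
    ← dotProduct_mulVec, mulVec_mulVec]

variable {Pi} in
/-- The expected weighted distance after a randomized block update. -/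
lemma sum_mul_mNormSq_blockUSet (hPiSum : ∑ I : Finset (Fin d), Pi I = 1)
    (hpPos : ∀ i, 0 < pblock Pi i) {T : Matrix (Fin m) (Fin m) ℝ}
    (hT : ∀ j j' : Fin m, blk j ≠ blk j' → T j j' = 0) (hPT : (Pmat blk Pi * T).IsSymm)
    (w g : Fin m → ℝ) :
    ∑ I : Finset (Fin d), Pi I *
        mNormSq (Pmat blk Pi * Pmat blk Pi * T) (w + blockUSet blk I *ᵥ g)
      = mNormSq (Pmat blk Pi * Pmat blk Pi * T) w + mNormSq (Pmat blk Pi * T) (w + g)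
        - mNormSq (Pmat blk Pi * T) w := by
  have hN := Pmat_mul_block blk Pi hT
  have hM := Pmat_mul_block blk Pi hN
  rw [Matrix.mul_assoc, mNormSq_add hPT]
  set N := Pmat blk Pi * T with hNdef
  have hMsymm : (Pmat blk Pi * N).IsSymm := by
    rw [IsSymm, transpose_mul, hPT.eq, (Pmat_isSymm blk Pi).eq, Pmat_comm blk Pi hN]
  have h : ∀ I, Pi I * mNormSq (Pmat blk Pi * N) (w + blockUSet blk I *ᵥ g)
      = Pi I * mNormSq (Pmat blk Pi * N) w
        + 2 * (Pi I * ((Pmat blk Pi *ᵥ (N *ᵥ w)) ⬝ᵥ (blockUSet blk I *ᵥ g)))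
        + Pi I * ((Pmat blk Pi *ᵥ (N *ᵥ g)) ⬝ᵥ (blockUSet blk I *ᵥ g)) := by
    intro I
    have h2 : mNormSq (Pmat blk Pi * N) (blockUSet blk I *ᵥ g)
        = (Pmat blk Pi *ᵥ (N *ᵥ g)) ⬝ᵥ (blockUSet blk I *ᵥ g) := by
      rw [mNormSq, mulVec_mulVec, ← blockUSet_comm blk hM, ← mulVec_mulVec, dotProduct_comm,
        dotProduct_mulVec, ← mulVec_transpose, (blockUSet_isSymm blk I).eq, mulVec_mulVec,
        blockUSet_mul_self, dotProduct_comm, mulVec_mulVec]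
    rw [mNormSq_add hMsymm, h2, ← mulVec_mulVec w]
    ring
  simp only [h, Finset.sum_add_distrib]
  rw [← Finset.sum_mul, hPiSum, ← Finset.mul_sum, sum_mul_Pmat_dotProduct_blockUSet blk hpPos,
    sum_mul_Pmat_dotProduct_blockUSet blk hpPos]
  simp only [mNormSq]
  ring

variable {Pi} in
/-- The expected value of `h` after a randomized block update. -/
lemma sum_mul_quadH_blockUSet (hPiSum : ∑ I : Finset (Fin d), Pi I = 1)
    (hpPos : ∀ i, 0 < pblock Pi i) (A : Matrix (Fin q) (Fin m) ℝ) (b : Fin q → ℝ)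
    {y : Fin m → ℝ} (hy : Aᵀ *ᵥ (A *ᵥ y - b) = 0) (z g : Fin m → ℝ) (t : ℝ) :
    ∑ I : Finset (Fin d), Pi I *
        (quadH A b (z + t • ((blockUSet blk I * Pmat blk Pi) *ᵥ g)) - quadH A b y)
      = (quadH A b z - quadH A b y) + t * (gradH A b z ⬝ᵥ g)
        + t ^ 2 / 2 * mNormSq (SigmaMat A blk Pi) g := by
  simp only [quadH_add_sub A b hy, mul_add, Finset.sum_add_distrib, mul_left_comm (Pi _)]
  rw [← Finset.mul_sum, ← Finset.mul_sum, ← Finset.sum_mul, hPiSum, mNormSq_SigmaMat,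
    sum_mul_dotProduct_blockUSet_mul_Pmat blk hpPos, one_mul]

end Sampling

lemma add_dotProduct_le_of_convexOn {m : ℕ} {φ : (Fin m → ℝ) → ℝ}
    (hφ : ConvexOn ℝ Set.univ φ) {x g : Fin m → ℝ} (hg : HasFDerivAt φ (dotCLM g) x)
    (y : Fin m → ℝ) : φ x + g ⬝ᵥ (y - x) ≤ φ y := by
  have hline : HasDerivAt (fun t : ℝ => x + t • (y - x)) (y - x) 0 := by
    simpa using ((hasDerivAt_id (0 : ℝ)).smul_const (y - x)).const_add x
  have hd : HasDerivAt (fun t : ℝ => φ (x + t • (y - x))) (g ⬝ᵥ (y - x)) 0 := by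
    have hg' : HasFDerivAt φ (dotCLM g) (x + (0 : ℝ) • (y - x)) := by simpa using hg
    exact hg'.comp_hasDerivAt (0 : ℝ) hline
  have hc : ConvexOn ℝ Set.univ (fun t : ℝ => φ (x + t • (y - x))) := by
    have := hφ.comp_affineMap (AffineMap.lineMap x y : ℝ →ᵃ[ℝ] (Fin m → ℝ))
    simpa [Function.comp_def, AffineMap.lineMap_apply, add_comm] using this
  have h := hc.le_slope_of_hasDerivAt (Set.mem_univ 0) (Set.mem_univ 1) one_pos hd
  simp only [slope_def_field, one_smul, zero_smul, add_zero, add_sub_cancel, sub_zero,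
    div_one] at h
  linarith

/-- Lyapunov decrease (inequality (26) of the paper): in the setting of the one-step
estimate, if `θ⁺ ∈ (0,1]` satisfies `(1−θ⁺)/θ⁺ ≤ 1/θ` and `Φ̂⁺(I) ≥ Φ(x*)` for every
`I`, then `E[V⁺(I)] ≤ V − σ(h(x) − h(x*)) − (1/2)‖x̂ − x‖²_{PT − Λ − σΣ}`, where
`V, V⁺(I)` are the Lyapunov values built from `(Φ̂, s, x)` and `(Φ̂⁺(I), s⁺(I), x⁺(I))`. -/
theorem lyapunov_decrease {m q d : ℕ}
    (A : Matrix (Fin q) (Fin m) ℝ) (b : Fin q → ℝ)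
    (blk : Fin m → Fin d) (Pi : Finset (Fin d) → ℝ)
    (hPiNonneg : ∀ I, 0 ≤ Pi I) (hPiSum : ∑ I : Finset (Fin d), Pi I = 1)
    (hpPos : ∀ i, 0 < pblock Pi i)
    (r : (Fin m → ℝ) → EReal)
    (hrBot : ∀ u, r u ≠ ⊥) (hrTop : ∃ u, r u ≠ ⊤)
    (hrClosed : LowerSemicontinuous r)
    (hrConvex : ∀ u v : Fin m → ℝ, ∀ a c : ℝ, 0 ≤ a → 0 ≤ c → a + c = 1 →
      r (a • u + c • v) ≤ (a : EReal) * r u + (c : EReal) * r v)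
    (φ : (Fin m → ℝ) → ℝ) (hφConvex : ConvexOn ℝ Set.univ φ)
    (gφ : (Fin m → ℝ) → Fin m → ℝ)
    (hφDiff : ∀ u, HasFDerivAt φ (dotCLM (gφ u)) u)
    (Λ : Matrix (Fin m) (Fin m) ℝ) (hΛpsd : Λ.PosSemidef)
    (hφSmooth : ∀ u v : Fin m → ℝ, r u ≠ ⊤ → r v ≠ ⊤ →
      φ v ≤ φ u + gφ u ⬝ᵥ (v - u) + (1 / 2) * mNormSq Λ (v - u))
    (T : Matrix (Fin m) (Fin m) ℝ)
    (hTblock : ∀ j j' : Fin m, blk j ≠ blk j' → T j j' = 0)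
    (hPT : (Pmat blk Pi * T).PosDef)
    (θ σ : ℝ) (hθ0 : 0 < θ) (hθ1 : θ ≤ 1) (hσ : 0 < σ)
    (x s xstar : Fin m → ℝ)
    (hxdom : r x ≠ ⊤) (hxstardom : r xstar ≠ ⊤)
    (hxstar : Aᵀ *ᵥ (A *ᵥ xstar - b) = 0)
    (z : Fin m → ℝ) (hz : z = (1 - θ) • s + θ • x)
    (xhat : Fin m → ℝ)
    (hmin : ∀ u : Fin m → ℝ,
      (((gφ x + (σ / θ) • gradH A b z) ⬝ᵥ xhat
          + (1 / 2) * mNormSq (Pmat blk Pi * T) (xhat - x) : ℝ) : EReal) + r xhat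
        ≤ (((gφ x + (σ / θ) • gradH A b z) ⬝ᵥ u
          + (1 / 2) * mNormSq (Pmat blk Pi * T) (u - x) : ℝ) : EReal) + r u)
    (ρ : ℝ) (hρ : r xhat = (ρ : EReal))
    (ρs : ℝ) (hρs : r xstar = (ρs : EReal))
    (Φhat : ℝ) (Φhatp : Finset (Fin d) → ℝ)
    (hΦexp : ∑ I : Finset (Fin d), Pi I * Φhatp I
      = (1 - θ) * Φhat + θ * (φ xhat + ρ))
    (θp : ℝ) (hθp0 : 0 < θp) (hθp1 : θp ≤ 1)
    (hθθp : (1 - θp) / θp ≤ 1 / θ)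
    (hΦhatpGe : ∀ I : Finset (Fin d), φ xstar + ρs ≤ Φhatp I) :
    ∑ I : Finset (Fin d), Pi I *
        (((1 - θp) / θp) * (Φhatp I - (φ xstar + ρs))
          + (σ * (1 - θp) ^ 2 / θp ^ 2) *
            (quadH A b (z + θ • ((blockUSet blk I * Pmat blk Pi) *ᵥ (xhat - x)))
              - quadH A b xstar)
          + (1 / 2) * mNormSq (Pmat blk Pi * Pmat blk Pi * T)
              (x + blockUSet blk I *ᵥ (xhat - x) - xstar))
      ≤ (((1 - θ) / θ) * (Φhat - (φ xstar + ρs))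
          + (σ * (1 - θ) ^ 2 / θ ^ 2) * (quadH A b s - quadH A b xstar)
          + (1 / 2) * mNormSq (Pmat blk Pi * Pmat blk Pi * T) (x - xstar))
        - σ * (quadH A b x - quadH A b xstar)
        - (1 / 2) * mNormSq (Pmat blk Pi * T - Λ - σ • SigmaMat A blk Pi) (xhat - x) := by
  have hsymm : (Pmat blk Pi * T).IsSymm := by
    rw [IsSymm, ← conjTranspose_eq_transpose_of_trivial]
    exact hPT.isHermitian
  have hprox := prox_three_point hrConvex hsymm hmin hρ hρs
  have hsmooth := hφSmooth x xhat hxdom (by rw [hρ]; exact EReal.coe_ne_top ρ)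
  have hconv := add_dotProduct_le_of_convexOn hφConvex (hφDiff x) xstar
  have hh := quadH_convexComb_sub A b hxstar θ s x z hz
  have hE1 : ∑ I : Finset (Fin d), Pi I * (Φhatp I - (φ xstar + ρs))
      = (1 - θ) * Φhat + θ * (φ xhat + ρ) - (φ xstar + ρs) := by
    simp only [mul_sub, Finset.sum_sub_distrib]
    rw [hΦexp, ← Finset.sum_mul, hPiSum, one_mul]
  have hE2 := sum_mul_quadH_blockUSet blk hPiSum hpPos A b hxstar z (xhat - x) θ
  have hE3 := sum_mul_mNormSq_blockUSet blk hPiSum hpPos hTblock hsymm (x - xstar) (xhat - x)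
  have hN : mNormSq (Pmat blk Pi * T - Λ - σ • SigmaMat A blk Pi) (xhat - x)
      = mNormSq (Pmat blk Pi * T) (xhat - x) - mNormSq Λ (xhat - x)
        - σ * mNormSq (SigmaMat A blk Pi) (xhat - x) := by
    simp only [mNormSq, sub_mulVec, smul_mulVec, sub_dotProduct, smul_dotProduct, smul_eq_mul]
  have hcoef : σ * (1 - θp) ^ 2 / θp ^ 2 ≤ σ * (1 / θ) ^ 2 := by
    rw [mul_div_assoc, ← div_pow]
    have : 0 ≤ (1 - θp) / θp := div_nonneg (by linarith) hθp0.le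
    gcongr
  have hnn1 : 0 ≤ ∑ I : Finset (Fin d), Pi I * (Φhatp I - (φ xstar + ρs)) :=
    Finset.sum_nonneg fun I _ => mul_nonneg (hPiNonneg I) (sub_nonneg.2 (hΦhatpGe I))
  have hnn2 : 0 ≤ ∑ I : Finset (Fin d), Pi I *
      (quadH A b (z + θ • ((blockUSet blk I * Pmat blk Pi) *ᵥ (xhat - x)))
        - quadH A b xstar) := by
    refine Finset.sum_nonneg fun I _ => mul_nonneg (hPiNonneg I) ?_
    rw [quadH_sub A b hxstar]
    exact mul_nonneg (by norm_num) (Finset.sum_nonneg fun i _ => mul_self_nonneg _)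
  have hm1 := mul_le_mul_of_nonneg_right hθθp hnn1
  have hm2 := mul_le_mul_of_nonneg_right hcoef hnn2
  have hshift : ∀ I, x + blockUSet blk I *ᵥ (xhat - x) - xstar
      = x - xstar + blockUSet blk I *ᵥ (xhat - x) := fun I => by abel
  simp only [hshift, mul_add, Finset.sum_add_distrib, mul_left_comm (Pi _)]
  rw [← Finset.mul_sum, ← Finset.mul_sum, ← Finset.mul_sum, hE3, hN]
  rw [hE1] at hm1 hnn1 ⊢
  rw [hE2] at hm2 hnn2 ⊢
  have e1 : xhat - xstar = (xhat - x) + (x - xstar) := by abel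
  have e2 : xstar - x = -(x - xstar) := by abel
  rw [e1] at hprox
  simp only [add_dotProduct, dotProduct_add, smul_dotProduct, smul_eq_mul] at hprox
  rw [e2, dotProduct_neg] at hconv
  have hm1' : 1 / θ * ((1 - θ) * Φhat + θ * (φ xhat + ρ) - (φ xstar + ρs))
      = (1 - θ) / θ * (Φhat - (φ xstar + ρs)) + (φ xhat + ρ - (φ xstar + ρs)) := by
    field_simp
    ring
  have hm2' : σ * (1 / θ) ^ 2 * ((quadH A b z - quadH A b xstar)
        + θ * (gradH A b z ⬝ᵥ (xhat - x))
        + θ ^ 2 / 2 * mNormSq (SigmaMat A blk Pi) (xhat - x))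
      = σ * (1 - θ) ^ 2 / θ ^ 2 * (quadH A b s - quadH A b xstar)
        - σ * (quadH A b x - quadH A b xstar)
        + σ / θ * (gradH A b z ⬝ᵥ (x - xstar)) + σ / θ * (gradH A b z ⬝ᵥ (xhat - x))
        + σ / 2 * mNormSq (SigmaMat A blk Pi) (xhat - x) := by
    rw [eq_add_of_sub_eq hh]
    field_simp
  rw [hm1'] at hm1
  rw [hm2'] at hm2
  linarith
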